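/- Let (a_n)_{n≥1} and (b_n)_{n≥1} be sequences of positive integers with α₁ ≤ a_n ≤ α₂ and β₁ ≤ b_n ≤ β₂ for all n ≥ 1, where α₁, α₂, β₁, β₂ are positive integers satisfying γ₁ := (β₁ + √(β₁² + 4α₁))/2 > α₂. Then the generalized continued fraction K_{n=1}^∞ a_n/b_n converges to an irrational number τ, and μ_I(τ) ≤ 2 + (log α₂)/(log γ₁ − log α₂). -/

import Mathlib

open Filter Real

/-- The asymptotic irrationality exponent: the infimum (in `EReal`, so that the
infimum of the empty set is `∞`) of all real `μ` for which there exist `c > 0`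
and `N₀ > 0` with `|τ - M/N| ≥ c / N ^ μ` for all integers `M, N` with `N ≥ N₀`. -/
noncomputable def muI (τ : ℝ) : EReal :=
  sInf ((fun μ : ℝ => (μ : EReal)) ''
    {μ : ℝ | ∃ c > (0:ℝ), ∃ N₀ > (0:ℝ), ∀ M N : ℤ,
      (N : ℝ) ≥ N₀ → |τ - (M : ℝ) / (N : ℝ)| ≥ c / (N : ℝ) ^ μ})

/-- Numerators of the convergents of the generalized continued fraction
`K_{n=1}^∞ a n / b n`. -/
def cfA (a b : ℕ → ℤ) : ℕ → ℤ
  | 0 => 0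
  | 1 => a 1
  | (n + 2) => b (n + 2) * cfA a b (n + 1) + a (n + 2) * cfA a b n

/-- Denominators of the convergents of the generalized continued fraction
`K_{n=1}^∞ a n / b n`. -/
def cfB (a b : ℕ → ℤ) : ℕ → ℤ
  | 0 => 1
  | 1 => b 1
  | (n + 2) => b (n + 2) * cfB a b (n + 1) + a (n + 2) * cfB a b n

section Convergents

variable {a b : ℕ → ℤ}

theorem cfB_succ_succ (a b : ℕ → ℤ) (n : ℕ) :
    cfB a b (n + 2) = b (n + 2) * cfB a b (n + 1) + a (n + 2) * cfB a b n := by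
  rw [cfB]

theorem cfA_succ_succ (a b : ℕ → ℤ) (n : ℕ) :
    cfA a b (n + 2) = b (n + 2) * cfA a b (n + 1) + a (n + 2) * cfA a b n := by
  rw [cfA]

/-- The determinant formula for consecutive convergents. -/
theorem cfA_mul_cfB_sub (a b : ℕ → ℤ) (n : ℕ) :
    cfA a b (n + 1) * cfB a b n - cfA a b n * cfB a b (n + 1) =
      (-1) ^ n * ∏ i ∈ Finset.range (n + 1), a (i + 1) := by
  induction n with
  | zero => simp [cfA, cfB]
  | succ n ih =>
    rw [Finset.prod_range_succ, cfA_succ_succ, cfB_succ_succ, pow_succ]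
    linear_combination (-a (n + 2)) * ih

theorem cfB_pos_and_le_succ (ha : ∀ n, 1 ≤ n → 0 < a n) (hb : ∀ n, 1 ≤ n → 0 < b n) (n : ℕ) :
    0 < cfB a b n ∧ cfB a b n ≤ cfB a b (n + 1) := by
  induction n with
  | zero => exact ⟨one_pos, hb 1 le_rfl⟩
  | succ n ih =>
    have h1 := ha (n + 2) (by omega)
    have h2 := hb (n + 2) (by omega)
    refine ⟨by omega, ?_⟩
    rw [cfB_succ_succ]
    nlinarith [mul_pos h1 ih.1]

theorem cfB_pos (ha : ∀ n, 1 ≤ n → 0 < a n) (hb : ∀ n, 1 ≤ n → 0 < b n) (n : ℕ) :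
    0 < cfB a b n :=
  (cfB_pos_and_le_succ ha hb n).1

theorem prod_numerators_pos (ha : ∀ n, 1 ≤ n → 0 < a n) (n : ℕ) :
    0 < ∏ i ∈ Finset.range n, a (i + 1) :=
  Finset.prod_pos fun i _ => ha (i + 1) (by omega)

theorem cfB_succ_le (ha : ∀ n, 1 ≤ n → 0 < a n) (hb : ∀ n, 1 ≤ n → 0 < b n) {α β : ℤ}
    (hα : ∀ n, 1 ≤ n → a n ≤ α) (hβ : ∀ n, 1 ≤ n → b n ≤ β) (n : ℕ) :
    cfB a b (n + 1) ≤ (β + α) * cfB a b n := by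
  have h1 := ha 1 le_rfl
  have h2 := hα 1 le_rfl
  have h3 := hβ 1 le_rfl
  cases n with
  | zero => simp only [cfB]; omega
  | succ n =>
    obtain ⟨h4, h5⟩ := cfB_pos_and_le_succ ha hb n
    rw [cfB_succ_succ]
    nlinarith [mul_le_mul_of_nonneg_right (hβ (n + 2) (by omega)) (h4.le.trans h5),
      mul_le_mul_of_nonneg_right (hα (n + 2) (by omega)) h4.le,
      mul_le_mul_of_nonneg_left h5 (h1.le.trans h2)]

/-- The denominators grow at least like the powers of a root `γ` of `γ ^ 2 = β γ + α`, if `α` and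
`β` bound the partial numerators and denominators from below. -/
theorem le_cfB_of_sq_eq {α β γ : ℝ} (hα : 0 ≤ α) (hβ : 0 ≤ β) (hγ : 0 < γ) (hβγ : β ≤ γ)
    (hγ2 : γ ^ 2 = β * γ + α) (ha : ∀ n, 1 ≤ n → α ≤ a n) (hb : ∀ n, 1 ≤ n → β ≤ b n) (n : ℕ) :
    β / γ * γ ^ n ≤ cfB a b n ∧ β / γ * γ ^ (n + 1) ≤ cfB a b (n + 1) := by
  induction n with
  | zero =>
    refine ⟨?_, ?_⟩
    · simpa [cfB] using (div_le_one hγ).2 hβγ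
    · simpa [cfB, hγ.ne'] using hb 1 le_rfl
  | succ n ih =>
    refine ⟨ih.2, ?_⟩
    have h0 : 0 ≤ β / γ * γ ^ n := by positivity
    have h1 : 0 ≤ β / γ * γ ^ (n + 1) := by positivity
    have e : β / γ * γ ^ (n + 1 + 1) = β * (β / γ * γ ^ (n + 1)) + α * (β / γ * γ ^ n) := by
      rw [pow_succ, pow_succ]
      linear_combination (β / γ * γ ^ n) * hγ2
    rw [e, cfB_succ_succ]
    push_cast
    exact add_le_add
      (mul_le_mul (hb _ (by omega)) ih.2 h1 (hβ.trans (hb _ (by omega))))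
      (mul_le_mul (ha _ (by omega)) ih.1 h0 (hα.trans (ha _ (by omega))))

/-- If the products of the partial numerators are negligible compared with the denominators, then
the continued fraction converges, with the usual bound for the remainders. -/
theorem exists_tendsto_cfA_div_cfB (ha : ∀ n, 1 ≤ n → 0 < a n) (hb : ∀ n, 1 ≤ n → 0 < b n)
    (h : Tendsto (fun n => ((∏ i ∈ Finset.range n, a (i + 1) : ℤ) : ℝ) / cfB a b n) atTop
      (nhds 0)) :
    ∃ τ : ℝ, Tendsto (fun n => (cfA a b n : ℝ) / (cfB a b n : ℝ)) atTop (nhds τ) ∧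
      ∀ n, |cfB a b n * τ - cfA a b n| ≤
        ((∏ i ∈ Finset.range (n + 1), a (i + 1) : ℤ) : ℝ) / cfB a b (n + 1) := by
  set P : ℕ → ℤ := fun n => ∏ i ∈ Finset.range n, a (i + 1) with hP
  set d : ℕ → ℝ := fun n => (P (n + 1) : ℝ) / cfB a b (n + 1) / cfB a b n with hd
  have hB : ∀ n, (0 : ℝ) < cfB a b n := fun n => by exact_mod_cast cfB_pos ha hb n
  have hB1 : ∀ n, (1 : ℝ) ≤ cfB a b n := fun n => by exact_mod_cast cfB_pos ha hb n
  have hPpos : ∀ n, (0 : ℝ) < P n := fun n => by exact_mod_cast prod_numerators_pos ha n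
  have hd0 : ∀ n, 0 ≤ d n := fun n => by
    have := hB n; have := hB (n + 1); have := hPpos (n + 1)
    simp only [hd]; positivity
  have hanti : Antitone d := by
    refine antitone_nat_of_succ_le fun n => ?_
    have h0 := hB n
    have h1 := hB (n + 1)
    have h2 := hB (n + 2)
    have hp := hPpos (n + 1)
    have e : (P (n + 2) : ℝ) = P (n + 1) * a (n + 2) := by
      simp only [hP]; rw [Finset.prod_range_succ]; push_cast; ring
    have e2 : (cfB a b (n + 2) : ℝ) = b (n + 2) * cfB a b (n + 1) + a (n + 2) * cfB a b n := by
      rw [cfB_succ_succ]; push_cast; ring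
    have hb' : (0 : ℝ) < b (n + 2) := by exact_mod_cast hb (n + 2) (by omega)
    simp only [hd]
    rw [show n + 1 + 1 = n + 2 from rfl, div_div, div_div,
      div_le_div_iff₀ (by positivity) (by positivity), e]
    have : (a (n + 2) : ℝ) * cfB a b n ≤ cfB a b (n + 2) := by
      rw [e2]; nlinarith [mul_pos hb' h1]
    calc _ = (P (n + 1) : ℝ) * cfB a b (n + 1) * (a (n + 2) * cfB a b n) := by ring
      _ ≤ P (n + 1) * cfB a b (n + 1) * cfB a b (n + 2) := by gcongr
      _ = _ := by ring
  have hlim : Tendsto d atTop (nhds 0) := by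
    refine squeeze_zero hd0 (fun n => ?_) ((tendsto_add_atTop_iff_nat 1).2 h)
    have := hB (n + 1); have := hPpos (n + 1)
    exact div_le_self (by positivity) (hB1 n)
  have hsum : ∀ n, ∑ i ∈ Finset.range n, (-1) ^ i * d i = (cfA a b n : ℝ) / cfB a b n := by
    intro n
    induction n with
    | zero => simp [cfA]
    | succ n ih =>
      have h0 := (hB n).ne'
      have h1 := (hB (n + 1)).ne'
      have hdet : (cfA a b (n + 1) : ℝ) * cfB a b n - cfA a b n * cfB a b (n + 1) =
          (-1) ^ n * P (n + 1) := by exact_mod_cast cfA_mul_cfB_sub a b n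
      rw [Finset.sum_range_succ, ih]
      simp only [hd]
      field_simp
      linear_combination -hdet
  obtain ⟨τ, hτ⟩ := hanti.tendsto_alternating_series_of_tendsto_zero hlim
  refine ⟨τ, by simpa only [hsum] using hτ, fun n => ?_⟩
  have key : |τ - (cfA a b n : ℝ) / cfB a b n| ≤ d n := by
    rw [← hsum]
    obtain ⟨k, rfl | rfl⟩ := n.even_or_odd'
    · have h1 := hanti.alternating_series_le_tendsto hτ k
      have h2 := hanti.tendsto_le_alternating_series hτ k
      rw [Finset.sum_range_succ, pow_mul] at h2
      norm_num at h2
      exact abs_le.2 ⟨by linarith [hd0 (2 * k)], by linarith⟩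
    · have h1 := hanti.alternating_series_le_tendsto hτ (k + 1)
      have h2 := hanti.tendsto_le_alternating_series hτ k
      rw [show 2 * (k + 1) = 2 * k + 1 + 1 by ring, Finset.sum_range_succ, pow_succ, pow_mul] at h1
      norm_num at h1
      exact abs_le.2 ⟨by linarith, by linarith [hd0 (2 * k + 1)]⟩
  have h0 := hB n
  have e : (cfB a b n : ℝ) * τ - cfA a b n = cfB a b n * (τ - (cfA a b n : ℝ) / cfB a b n) := by
    field_simp
  rw [e, abs_mul, abs_of_pos h0]
  calc _ ≤ (cfB a b n : ℝ) * d n := by gcongr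
    _ = _ := mul_div_cancel₀ _ h0.ne'

end Convergents

/-- A small linear form `q τ - p` separates `τ` from every rational `M / N` different from
`p / q`. -/
theorem one_le_two_mul_abs_of_small_linear_form {τ : ℝ} {p q M N : ℤ} (hq : 0 < q) (hN : 0 < N)
    (hne : N * p - M * q ≠ 0) (hsmall : N * |q * τ - p| ≤ 1 / 2) :
    1 ≤ 2 * (q * |N * τ - M|) := by
  have hq' : (0 : ℝ) < q := by exact_mod_cast hq
  have hN' : (0 : ℝ) < N := by exact_mod_cast hN
  have h1 : (1 : ℝ) ≤ |(N : ℝ) * p - M * q| := by exact_mod_cast Int.one_le_abs hne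
  have h2 : |(N : ℝ) * p - M * q| ≤ q * |N * τ - M| + N * |q * τ - p| := by
    calc |(N : ℝ) * p - M * q| = |q * (N * τ - M) - N * (q * τ - p)| := by congr 1; ring
      _ ≤ |q * (N * τ - M)| + |N * (q * τ - p)| := abs_sub _ _
      _ = _ := by rw [abs_mul, abs_mul, abs_of_pos hq', abs_of_pos hN']
  linarith

theorem irrational_of_forall_le_abs_sub {τ μ c N₀ : ℝ} (hc : 0 < c) (hN₀ : 0 < N₀)
    (h : ∀ M N : ℤ, (N : ℝ) ≥ N₀ → |τ - (M : ℝ) / (N : ℝ)| ≥ c / (N : ℝ) ^ μ) :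
    Irrational τ := by
  rintro ⟨r, rfl⟩
  obtain ⟨k, hk⟩ := exists_nat_ge N₀
  have hk0 : (0 : ℝ) < k := hN₀.trans_le hk
  have hd : (1 : ℝ) ≤ r.den := by exact_mod_cast r.den_pos
  have hN : (((r.den * k : ℕ) : ℤ) : ℝ) ≥ N₀ := by
    push_cast
    nlinarith
  have := h (r.num * k) (r.den * k : ℕ) hN
  have e : (r : ℝ) - ((r.num * k : ℤ) : ℝ) / (((r.den * k : ℕ) : ℤ) : ℝ) = 0 := by
    push_cast
    rw [mul_div_mul_right _ _ hk0.ne', Rat.cast_def, sub_self]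
  rw [e, abs_zero] at this
  have : 0 < c / (((r.den * k : ℕ) : ℤ) : ℝ) ^ μ :=
    div_pos hc (rpow_pos_of_pos (hN₀.trans_le hN) _)
  linarith

/-- If `B ≥ c γ ^ k` and `B < 2 N α ^ k` with `1 ≤ α < γ`, then `B` is bounded by a constant
multiple of the power of `N` with exponent `1 + log α / (log γ - log α)`. -/
theorem le_rpow_of_lt_two_mul_pow {α γ c B N : ℝ} {k : ℕ} (hα : 1 ≤ α) (hγ : α < γ) (hc : 0 < c)
    (hN : 0 < N) (hB : c * γ ^ k ≤ B) (hBN : B < 2 * N * α ^ k) :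
    B ≤ c * (2 / c) ^ (1 + log α / (log γ - log α)) *
      N ^ (1 + log α / (log γ - log α)) := by
  have hα0 : 0 < α := by linarith
  have hγ0 : 0 < γ := by linarith
  have hlog : 0 < log γ - log α := sub_pos.2 (log_lt_log hα0 hγ)
  have hB0 : 0 < B := lt_of_lt_of_le (by positivity) hB
  have hαl : 0 ≤ log α := log_nonneg hα
  have hlB : log c + k * log γ ≤ log B := by
    rw [← log_pow, ← log_mul hc.ne' (by positivity)]
    exact log_le_log (by positivity) hB
  have hlN : log B ≤ log 2 + log N + k * log α := by
    rw [← log_pow, ← log_mul two_ne_zero hN.ne', ← log_mul (by positivity) (by positivity)]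
    exact log_le_log hB0 hBN.le
  have hk : log B - log c ≤
      (log 2 - log c + log N) * (1 + log α / (log γ - log α)) := by
    have e : 1 + log α / (log γ - log α) = log γ / (log γ - log α) := by
      field_simp; ring
    rw [e, mul_div_assoc', le_div_iff₀ hlog]
    have hγl : 0 ≤ log γ := by linarith
    nlinarith [mul_le_mul_of_nonneg_left hlB hαl, mul_le_mul_of_nonneg_left hlN hγl]
  rw [← log_le_log_iff hB0 (by positivity), log_mul (by positivity) (by positivity),
    log_mul (by positivity) (by positivity), log_rpow (by positivity), log_rpow hN,
    log_div two_ne_zero hc.ne']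
  linarith


/-- bounded partial coefficients.  If `α₁ ≤ a_n ≤ α₂`,
`β₁ ≤ b_n ≤ β₂` and `γ₁ = (β₁ + √(β₁² + 4α₁))/2 > α₂`, then the continued
fraction converges to an irrational `τ` with
`μ_I(τ) ≤ 2 + log α₂ / (log γ₁ - log α₂)`. -/
theorem gcf_muI_le_of_bounded_coefficients
    (a b : ℕ → ℤ) (α₁ α₂ β₁ β₂ : ℤ)
    (hα₁ : 0 < α₁) (hα₂ : 0 < α₂) (hβ₁ : 0 < β₁) (hβ₂ : 0 < β₂)
    (ha : ∀ n, 1 ≤ n → α₁ ≤ a n ∧ a n ≤ α₂)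
    (hb : ∀ n, 1 ≤ n → β₁ ≤ b n ∧ b n ≤ β₂)
    (hγ : (α₂ : ℝ) < ((β₁ : ℝ) + Real.sqrt ((β₁ : ℝ) ^ 2 + 4 * (α₁ : ℝ))) / 2) :
    ∃ τ : ℝ,
      Tendsto (fun n => (cfA a b n : ℝ) / (cfB a b n : ℝ)) atTop (nhds τ) ∧
      Irrational τ ∧
      muI τ ≤ ((2 + Real.log (α₂ : ℝ) /
        (Real.log (((β₁ : ℝ) + Real.sqrt ((β₁ : ℝ) ^ 2 + 4 * (α₁ : ℝ))) / 2)
          - Real.log (α₂ : ℝ)) : ℝ) : EReal) := by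
  set γ : ℝ := ((β₁ : ℝ) + Real.sqrt ((β₁ : ℝ) ^ 2 + 4 * (α₁ : ℝ))) / 2 with hγdef
  have hα₁' : (0 : ℝ) < α₁ := by exact_mod_cast hα₁
  have hα₂' : (1 : ℝ) ≤ α₂ := by exact_mod_cast hα₂
  have hβ₁' : (0 : ℝ) < β₁ := by exact_mod_cast hβ₁
  have hsq := Real.sq_sqrt (show 0 ≤ (β₁ : ℝ) ^ 2 + 4 * (α₁ : ℝ) by positivity)
  have hle : (β₁ : ℝ) ≤ Real.sqrt ((β₁ : ℝ) ^ 2 + 4 * (α₁ : ℝ)) :=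
    Real.le_sqrt_of_sq_le (by linarith)
  have hγ0 : 0 < γ := by linarith
  have hβγ : (β₁ : ℝ) ≤ γ := by rw [hγdef]; linarith
  have hγ2 : γ ^ 2 = β₁ * γ + α₁ := by rw [hγdef]; linear_combination hsq / 4
  clear_value γ
  have ha0 : ∀ n, 1 ≤ n → 0 < a n := fun n hn => hα₁.trans_le (ha n hn).1
  have hb0 : ∀ n, 1 ≤ n → 0 < b n := fun n hn => hβ₁.trans_le (hb n hn).1
  have hBpos := cfB_pos ha0 hb0
  have hBpos' : ∀ n, (0 : ℝ) < cfB a b n := fun n => by exact_mod_cast hBpos n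
  have hBγ : ∀ n, β₁ / γ * γ ^ n ≤ cfB a b n := fun n =>
    (le_cfB_of_sq_eq hα₁'.le hβ₁'.le hγ0 hβγ hγ2
      (fun n hn => by exact_mod_cast (ha n hn).1) (fun n hn => by exact_mod_cast (hb n hn).1) n).1
  have hP : ∀ n, ((∏ i ∈ Finset.range n, a (i + 1) : ℤ) : ℝ) ≤ (α₂ : ℝ) ^ n := fun n => by
    have : ∏ i ∈ Finset.range n, a (i + 1) ≤ ∏ _i ∈ Finset.range n, α₂ :=
      Finset.prod_le_prod (fun i _ => (ha0 (i + 1) (by omega)).le)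
        (fun i _ => (ha (i + 1) (by omega)).2)
    rw [Finset.prod_const, Finset.card_range] at this
    exact_mod_cast this
  have hPpos : ∀ n, (0 : ℝ) < (∏ i ∈ Finset.range n, a (i + 1) : ℤ) := fun n => by
    exact_mod_cast prod_numerators_pos ha0 n
  have hlim : Tendsto (fun n => ((∏ i ∈ Finset.range n, a (i + 1) : ℤ) : ℝ) / cfB a b n) atTop
      (nhds 0) := by
    have hgeom : Tendsto (fun n : ℕ => γ / β₁ * (α₂ / γ) ^ n) atTop (nhds 0) := by
      simpa using (tendsto_pow_atTop_nhds_zero_of_lt_one (by positivity)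
        ((div_lt_one hγ0).2 hγ)).const_mul (γ / (β₁ : ℝ))
    refine squeeze_zero (fun n => (div_pos (hPpos n) (hBpos' n)).le) (fun n => ?_) hgeom
    calc _ ≤ (α₂ : ℝ) ^ n / (β₁ / γ * γ ^ n) :=
          div_le_div₀ (by positivity) (hP n) (by positivity) (hBγ n)
      _ = _ := by rw [div_pow]; field_simp
  obtain ⟨τ, hτ, hrem⟩ := exists_tendsto_cfA_div_cfB ha0 hb0 hlim
  set s : ℝ := 1 + log α₂ / (log γ - log α₂) with hs
  set K : ℝ := β₁ / γ * (2 / (β₁ / γ)) ^ s with hK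
  have hK0 : 0 < K := by positivity
  set C : ℝ := β₂ + α₂ with hC
  have hC1 : 1 ≤ C := by
    have : (0 : ℝ) < β₂ := by exact_mod_cast hβ₂
    linarith
  have hBC : ∀ n, (cfB a b (n + 1) : ℝ) ≤ C * cfB a b n := fun n => by
    rw [hC]
    exact_mod_cast cfB_succ_le ha0 hb0 (fun n hn => (ha n hn).2) (fun n hn => (hb n hn).2) n
  have main : ∀ M N : ℤ, (N : ℝ) ≥ 1 →
      |τ - (M : ℝ) / (N : ℝ)| ≥ 1 / (2 * C * K) / (N : ℝ) ^ (1 + s) := by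
    intro M N hN
    have hN0 : (0 : ℝ) < N := by linarith
    have hN0' : 0 < N := by exact_mod_cast hN0
    set e : ℕ → ℝ := fun n => ((∏ i ∈ Finset.range n, a (i + 1) : ℤ) : ℝ) / cfB a b n with he
    have hex : ∃ n, ∀ m, n ≤ m → N * e m ≤ 1 / 2 := by
      have h0 : Tendsto (fun n => N * e n) atTop (nhds 0) := by
        simpa using hlim.const_mul (N : ℝ)
      exact eventually_atTop.1 (h0.eventually_le_const (by norm_num))
    obtain ⟨k, hk, hk'⟩ : ∃ k, 1 / 2 < N * e k ∧ ∀ m, k < m → N * e m ≤ 1 / 2 := by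
      classical
      have hspec := Nat.find_spec hex
      have hmin := fun j hj => Nat.find_min hex (m := j) hj
      cases hn : Nat.find hex with
      | zero =>
        have := hspec 0 (by omega)
        simp [he, cfB] at this
        norm_num at this
        linarith
      | succ k =>
        rw [hn] at hspec
        refine ⟨k, ?_, fun m hm => hspec m hm⟩
        by_contra! hle
        refine hmin k (by omega) fun m hm => ?_
        rcases hm.eq_or_lt with rfl | hm
        · exact hle
        · exact hspec m hm
    have hsmall : ∀ j, k ≤ j → N * |cfB a b j * τ - cfA a b j| ≤ 1 / 2 := fun j hj =>
      (mul_le_mul_of_nonneg_left (hrem j) hN0.le).trans (hk' (j + 1) (by omega))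
    have hlow : 1 ≤ 2 * (C * cfB a b k * |N * τ - M|) := by
      by_cases hne : N * cfA a b k - M * cfB a b k = 0
      · have hne' : N * cfA a b (k + 1) - M * cfB a b (k + 1) ≠ 0 := fun h0 => by
          have hdet := cfA_mul_cfB_sub a b k
          have hz : N * ((-1) ^ k * ∏ i ∈ Finset.range (k + 1), a (i + 1)) = 0 := by
            rw [← hdet]
            linear_combination cfB a b k * h0 - cfB a b (k + 1) * hne
          have := prod_numerators_pos ha0 (k + 1)
          simp [hN0'.ne', this.ne'] at hz
        refine (one_le_two_mul_abs_of_small_linear_form (hBpos _) hN0' hne'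
          (hsmall (k + 1) (by omega))).trans ?_
        gcongr
        exact hBC k
      · refine (one_le_two_mul_abs_of_small_linear_form (hBpos _) hN0' hne
          (hsmall k le_rfl)).trans ?_
        gcongr
        exact le_mul_of_one_le_left (hBpos' k).le hC1
    have hBK : (cfB a b k : ℝ) ≤ K * (N : ℝ) ^ s := by
      refine le_rpow_of_lt_two_mul_pow (k := k) hα₂' hγ (by positivity) hN0 (hBγ k) ?_
      have h1 := hBpos' k
      simp only [he] at hk
      rw [mul_div_assoc', lt_div_iff₀ h1] at hk
      nlinarith [mul_le_mul_of_nonneg_left (hP k) hN0.le]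
    have hKN : 1 ≤ 2 * C * K * (N : ℝ) ^ s * |N * τ - M| := by
      calc (1 : ℝ) ≤ 2 * (C * cfB a b k * |N * τ - M|) := hlow
        _ ≤ 2 * (C * (K * (N : ℝ) ^ s) * |N * τ - M|) := by gcongr
        _ = _ := by ring
    have hτN : |N * τ - M| = N * |τ - (M : ℝ) / N| := by
      rw [← abs_of_pos hN0, ← abs_mul, abs_of_pos hN0]
      congr 1
      field_simp
    rw [ge_iff_le, div_div, div_le_iff₀ (by positivity), rpow_add hN0, rpow_one]
    rw [hτN] at hKN
    linarith
  have hc : 0 < 1 / (2 * C * K) := by positivity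
  refine ⟨τ, hτ, irrational_of_forall_le_abs_sub hc one_pos main, sInf_le ⟨_, ?_, rfl⟩⟩
  have e2 : 2 + log α₂ / (log γ - log α₂) = 1 + s := by rw [hs]; ring
  rw [e2]
  exact ⟨_, hc, 1, one_pos, main⟩
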